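/- Let (p, x, σ, β) be admissible parameters with z = p − Σ_{i=1}^{n−1} x_i²/σ_i > 0. The scalar curvature of the inner product S(p, x, σ, β) on 𝔠𝔥(n) equals τ = −(1/(2z))·[2n² + n + 1 + β·Σ_{i=1}^{n−1} (1/σ_i²)(z + x_i²/σ_i)]. -/

import Mathlib

noncomputable section

open Matrix BigOperators Finset

namespace CHn

/-- Structure constants of the Lie algebra 𝔠𝔥(n) in the ordered basis
`(X, Y_1, …, Y_{n-1}, Z_1, …, Z_{n-1}, W)`:
index `0 ↦ X`, indices `1,…,n-1 ↦ Y_1,…,Y_{n-1}`,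
indices `n,…,2n-2 ↦ Z_1,…,Z_{n-1}`, index `2n-1 ↦ W`.
The nonzero brackets are `[X,Y_i] = (1/2)Y_i`, `[X,Z_i] = (1/2)Z_i`,
`[X,W] = W`, `[Z_j,Y_i] = δ_{ij} W`. -/
def structC (n : ℕ) (i j k : Fin (2 * n)) : ℝ :=
  (if i.val = 0 ∧ j = k ∧ 1 ≤ j.val ∧ j.val ≤ 2 * n - 2 then (1 : ℝ) / 2 else 0)
  - (if j.val = 0 ∧ i = k ∧ 1 ≤ i.val ∧ i.val ≤ 2 * n - 2 then (1 : ℝ) / 2 else 0)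
  + (if i.val = 0 ∧ j.val = 2 * n - 1 ∧ k.val = 2 * n - 1 then (1 : ℝ) else 0)
  - (if j.val = 0 ∧ i.val = 2 * n - 1 ∧ k.val = 2 * n - 1 then (1 : ℝ) else 0)
  + (if n ≤ i.val ∧ i.val ≤ 2 * n - 2 ∧ i.val = j.val + (n - 1) ∧ k.val = 2 * n - 1
      then (1 : ℝ) else 0)
  - (if n ≤ j.val ∧ j.val ≤ 2 * n - 2 ∧ j.val = i.val + (n - 1) ∧ k.val = 2 * n - 1
      then (1 : ℝ) else 0)

/-- The Lie bracket of `𝔠𝔥(n)`, as a bilinear operation on coordinate vectors. -/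
def bracket (n : ℕ) (u v : Fin (2 * n) → ℝ) : Fin (2 * n) → ℝ :=
  fun k => ∑ i, ∑ j, u i * v j * structC n i j k

/-- `F` is the matrix (in the ordered basis) of a Lie algebra automorphism of `𝔠𝔥(n)`. -/
def IsAut (n : ℕ) (F : Matrix (Fin (2 * n)) (Fin (2 * n)) ℝ) : Prop :=
  IsUnit F ∧ ∀ u v, F.mulVec (bracket n u v) = bracket n (F.mulVec u) (F.mulVec v)

/-- The normal form `S(p, x, σ, β)`: the block matrix
`[[p, xᵀ, 0, 0], [x, σ, 0, 0], [0, 0, σ, 0], [0, 0, 0, β]]`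
with blocks of sizes `1, n-1, n-1, 1`. -/
def Sform (n : ℕ) (p : ℝ) (x σ : Fin (n - 1) → ℝ) (β : ℝ) :
    Matrix (Fin (2 * n)) (Fin (2 * n)) ℝ := fun i j =>
  if i.val = 0 ∧ j.val = 0 then p
  else if h : i.val = 0 ∧ 1 ≤ j.val ∧ j.val ≤ n - 1 then x ⟨j.val - 1, by omega⟩
  else if h : j.val = 0 ∧ 1 ≤ i.val ∧ i.val ≤ n - 1 then x ⟨i.val - 1, by omega⟩
  else if h : i = j ∧ 1 ≤ i.val ∧ i.val ≤ n - 1 then σ ⟨i.val - 1, by omega⟩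
  else if h : i = j ∧ n ≤ i.val ∧ i.val ≤ 2 * n - 2 then σ ⟨i.val - n, by omega⟩
  else if i = j ∧ i.val = 2 * n - 1 then β
  else 0

/-- Admissibility of the parameters `(p, x, σ, β)`:
`p, β > 0`, all `x_i ≥ 0`, `σ_1 ≥ … ≥ σ_{n-2} ≥ 1` and the convention `σ_{n-1} = 1`. -/
def Admissible (n : ℕ) (p : ℝ) (x σ : Fin (n - 1) → ℝ) (β : ℝ) : Prop :=
  0 < p ∧ 0 < β ∧ (∀ i, 0 ≤ x i) ∧ Antitone σ ∧ (∀ i, 1 ≤ σ i) ∧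
    ∀ _h : 1 ≤ n - 1, σ ⟨n - 2, by omega⟩ = 1

/-- `z = p - Σ_i x_i² / σ_i`. -/
def zval (n : ℕ) (p : ℝ) (x σ : Fin (n - 1) → ℝ) : ℝ :=
  p - ∑ i, (x i) ^ 2 / σ i

/-- The inner product on `𝔠𝔥(n)` determined by a matrix `S`. -/
def ip (n : ℕ) (S : Matrix (Fin (2 * n)) (Fin (2 * n)) ℝ) (u v : Fin (2 * n) → ℝ) : ℝ :=
  u ⬝ᵥ S.mulVec v

/-- The coordinates (w.r.t. the standard basis) of the Koszul form
`K(u,v)(T) = ⟨[u,v],T⟩ - ⟨[v,T],u⟩ + ⟨[T,u],v⟩`. -/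
def koszul (n : ℕ) (S : Matrix (Fin (2 * n)) (Fin (2 * n)) ℝ)
    (u v : Fin (2 * n) → ℝ) : Fin (2 * n) → ℝ := fun t =>
  ip n S (bracket n u v) (Pi.single t 1) - ip n S (bracket n v (Pi.single t 1)) u
    + ip n S (bracket n (Pi.single t 1) u) v

/-- The Levi-Civita product `∇_u v` of the inner product `S`,
i.e. the unique solution of the Koszul formula `2⟨∇_u v, T⟩ = K(u,v)(T)`
(for invertible symmetric `S`). -/
def nabla (n : ℕ) (S : Matrix (Fin (2 * n)) (Fin (2 * n)) ℝ)
    (u v : Fin (2 * n) → ℝ) : Fin (2 * n) → ℝ :=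
  (2 : ℝ)⁻¹ • (S⁻¹).mulVec (koszul n S u v)

/-- The curvature operator `R(u,v)w = ∇_u∇_v w - ∇_v∇_u w - ∇_{[u,v]} w`. -/
def curv (n : ℕ) (S : Matrix (Fin (2 * n)) (Fin (2 * n)) ℝ)
    (u v w : Fin (2 * n) → ℝ) : Fin (2 * n) → ℝ :=
  nabla n S u (nabla n S v w) - nabla n S v (nabla n S u w) - nabla n S (bracket n u v) w

/-- The Ricci form `Ric(u,v) = tr (T ↦ R(T,u)v)`. -/
def ricci (n : ℕ) (S : Matrix (Fin (2 * n)) (Fin (2 * n)) ℝ)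
    (u v : Fin (2 * n) → ℝ) : ℝ :=
  ∑ t, curv n S (Pi.single t 1) u v t

/-- The scalar curvature `τ = Σ_{i,j} g^{ij} Ric(e_i, e_j)`. -/
def scalarCurv (n : ℕ) (S : Matrix (Fin (2 * n)) (Fin (2 * n)) ℝ) : ℝ :=
  ∑ i, ∑ j, (S⁻¹) i j * ricci n S (Pi.single i 1) (Pi.single j 1)

/-- The wedge endomorphism `(u∧v)(w) = ⟨v,w⟩u - ⟨u,w⟩v`. -/
def wedge (n : ℕ) (S : Matrix (Fin (2 * n)) (Fin (2 * n)) ℝ)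
    (u v : Fin (2 * n) → ℝ) : (Fin (2 * n) → ℝ) → (Fin (2 * n) → ℝ) :=
  fun w => ip n S v w • u - ip n S u w • v

/-- The standard symplectic matrix `J_m = [[0, I_m], [-I_m, 0]]`. -/
def Jmat (m : ℕ) : Matrix (Fin (2 * m)) (Fin (2 * m)) ℝ := fun i j =>
  if j.val = i.val + m then 1 else if i.val = j.val + m then -1 else 0

/-- The block matrix `[[1, 0, 0], [u, M, 0], [a, vᵀ, λ]]`
with blocks of sizes `1, 2n-2, 1`. -/
def blockF (n : ℕ) (M : Matrix (Fin (2 * (n - 1))) (Fin (2 * (n - 1))) ℝ)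
    (u v : Fin (2 * (n - 1)) → ℝ) (a lam : ℝ) :
    Matrix (Fin (2 * n)) (Fin (2 * n)) ℝ := fun i j =>
  if i.val = 0 then (if j.val = 0 then 1 else 0)
  else if h : 1 ≤ i.val ∧ i.val ≤ 2 * n - 2 then
    (if j.val = 0 then u ⟨i.val - 1, by omega⟩
     else if h2 : 1 ≤ j.val ∧ j.val ≤ 2 * n - 2 then
       M ⟨i.val - 1, by omega⟩ ⟨j.val - 1, by omega⟩
     else 0)
  else
    (if j.val = 0 then a
     else if h2 : 1 ≤ j.val ∧ j.val ≤ 2 * n - 2 then v ⟨j.val - 1, by omega⟩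
     else lam)

/-- The metric is Einstein: the Ricci form is proportional to the inner product. -/
def IsEinstein (n : ℕ) (S : Matrix (Fin (2 * n)) (Fin (2 * n)) ℝ) : Prop :=
  ∃ c : ℝ, ∀ u v, ricci n S u v = c * ip n S u v

end CHn


namespace CHn

set_option linter.unusedSectionVars false

section Gen

variable {n : ℕ} {ι : Type} [Fintype ι] [DecidableEq ι]

lemma bracket_add_left (u u' v : Fin (2 * n) → ℝ) :
    bracket n (u + u') v = bracket n u v + bracket n u' v := by
  ext k; simp [bracket, add_mul, Finset.sum_add_distrib]

lemma bracket_add_right (u v v' : Fin (2 * n) → ℝ) :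
    bracket n u (v + v') = bracket n u v + bracket n u v' := by
  ext k; simp [bracket, add_mul, mul_add, Finset.sum_add_distrib]

lemma bracket_smul_left (a : ℝ) (u v : Fin (2 * n) → ℝ) :
    bracket n (a • u) v = a • bracket n u v := by
  ext k; simp [bracket, mul_assoc, Finset.mul_sum]

lemma bracket_smul_right (a : ℝ) (u v : Fin (2 * n) → ℝ) :
    bracket n u (a • v) = a • bracket n u v := by
  ext k; simp [bracket, mul_assoc, Finset.mul_sum, mul_left_comm]

/-- The bracket as a bilinear map. -/
def brL (n : ℕ) : (Fin (2 * n) → ℝ) →ₗ[ℝ] (Fin (2 * n) → ℝ) →ₗ[ℝ] (Fin (2 * n) → ℝ) :=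
  LinearMap.mk₂ ℝ (bracket n) bracket_add_left bracket_smul_left bracket_add_right
    bracket_smul_right

/-- The inner product as a bilinear map. -/
def ipL (n : ℕ) (S : Matrix (Fin (2 * n)) (Fin (2 * n)) ℝ) :
    (Fin (2 * n) → ℝ) →ₗ[ℝ] (Fin (2 * n) → ℝ) →ₗ[ℝ] ℝ :=
  LinearMap.mk₂ ℝ (ip n S) (by simp [ip]) (by simp [ip])
    (by simp [ip, Matrix.mulVec_add]) (by simp [ip, Matrix.mulVec_smul])

lemma bracket_eq (u v : Fin (2 * n) → ℝ) : bracket n u v = brL n u v := rfl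
lemma ip_eq (S : Matrix (Fin (2 * n)) (Fin (2 * n)) ℝ) (u v : Fin (2 * n) → ℝ) :
    ip n S u v = ipL n S u v := rfl

lemma vec_eq_sum (v : Fin (2 * n) → ℝ) : v = ∑ t, v t • (Pi.single t 1 : Fin (2 * n) → ℝ) := by
  ext k; simp [Finset.sum_apply, Pi.single_apply]

lemma koszul_dot (S : Matrix (Fin (2 * n)) (Fin (2 * n)) ℝ) (u v t : Fin (2 * n) → ℝ) :
    koszul n S u v ⬝ᵥ t = ip n S (bracket n u v) t - ip n S (bracket n v t) u
      + ip n S (bracket n t u) v := by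
  conv_rhs => rw [vec_eq_sum t]
  simp only [bracket_eq, ip_eq, map_sum, map_smul, LinearMap.sum_apply, LinearMap.smul_apply,
    ← Finset.sum_sub_distrib, ← Finset.sum_add_distrib, dotProduct, koszul]
  refine Finset.sum_congr rfl fun i _ => ?_
  simp only [smul_eq_mul]; ring

variable {S : Matrix (Fin (2 * n)) (Fin (2 * n)) ℝ} {Q : Matrix (Fin (2 * n)) ι ℝ}

/-- frame expansion of the Levi-Civita product -/
lemma nabla_frame (hinv : S⁻¹ = Q * Qᵀ) (u v : Fin (2 * n) → ℝ) :
    nabla n S u v = ∑ c, ((2 : ℝ)⁻¹ * (koszul n S u v ⬝ᵥ Q.col c)) • Q.col c := by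
  unfold nabla
  rw [hinv, ← Matrix.mulVec_mulVec]
  ext k
  simp only [Pi.smul_apply, Matrix.mulVec, dotProduct, smul_eq_mul, Finset.sum_apply,
    Finset.mul_sum, Finset.sum_mul, Matrix.transpose_apply, Matrix.col_apply]
  refine Finset.sum_congr rfl fun c _ => Finset.sum_congr rfl fun i _ => ?_
  ring

/-- structure constants in the frame -/
def cc (S : Matrix (Fin (2 * n)) (Fin (2 * n)) ℝ) (Q : Matrix (Fin (2 * n)) ι ℝ)
    (a b c : ι) : ℝ := ip n S (bracket n (Q.col a) (Q.col b)) (Q.col c)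

/-- Christoffel symbols in the frame -/
def GG (S : Matrix (Fin (2 * n)) (Fin (2 * n)) ℝ) (Q : Matrix (Fin (2 * n)) ι ℝ)
    (a b c : ι) : ℝ := (2 : ℝ)⁻¹ * (cc S Q a b c - cc S Q b c a + cc S Q c a b)

lemma nabla_col (hinv : S⁻¹ = Q * Qᵀ) (a b : ι) :
    nabla n S (Q.col a) (Q.col b) = ∑ c, GG S Q a b c • Q.col c := by
  rw [nabla_frame hinv]
  simp only [koszul_dot, GG, cc]

lemma koszul_add_left (u u' v : Fin (2 * n) → ℝ) :
    koszul n S (u + u') v = koszul n S u v + koszul n S u' v := by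
  ext t; simp only [koszul, bracket_eq, ip_eq, map_add, LinearMap.add_apply, Pi.add_apply]; ring
lemma koszul_smul_left (a : ℝ) (u v : Fin (2 * n) → ℝ) :
    koszul n S (a • u) v = a • koszul n S u v := by
  ext t; simp only [koszul, bracket_eq, ip_eq, map_smul, LinearMap.smul_apply, Pi.smul_apply,
    smul_eq_mul]; ring
lemma koszul_add_right (u v v' : Fin (2 * n) → ℝ) :
    koszul n S u (v + v') = koszul n S u v + koszul n S u v' := by
  ext t; simp only [koszul, bracket_eq, ip_eq, map_add, LinearMap.add_apply, Pi.add_apply]; ring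
lemma koszul_smul_right (a : ℝ) (u v : Fin (2 * n) → ℝ) :
    koszul n S u (a • v) = a • koszul n S u v := by
  ext t; simp only [koszul, bracket_eq, ip_eq, map_smul, LinearMap.smul_apply, Pi.smul_apply,
    smul_eq_mul]; ring

/-- The Levi-Civita product as a bilinear map. -/
def naL (n : ℕ) (S : Matrix (Fin (2 * n)) (Fin (2 * n)) ℝ) :
    (Fin (2 * n) → ℝ) →ₗ[ℝ] (Fin (2 * n) → ℝ) →ₗ[ℝ] (Fin (2 * n) → ℝ) :=
  LinearMap.mk₂ ℝ (nabla n S)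
    (by intros; simp only [nabla, koszul_add_left, Matrix.mulVec_add, smul_add])
    (by intros; simp only [nabla, koszul_smul_left, Matrix.mulVec_smul]; rw [smul_comm])
    (by intros; simp only [nabla, koszul_add_right, Matrix.mulVec_add, smul_add])
    (by intros; simp only [nabla, koszul_smul_right, Matrix.mulVec_smul]; rw [smul_comm])

lemma nabla_eq (u v : Fin (2 * n) → ℝ) : nabla n S u v = naL n S u v := rfl

lemma ipL_col (h1 : Qᵀ * S * Q = 1) (a b : ι) :
    ipL n S (Q.col a) (Q.col b) = if a = b then 1 else 0 := by
  have := congrFun (congrFun h1 a) b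
  rw [Matrix.one_apply] at this
  rw [← this, ← ip_eq, ip, Matrix.mul_assoc]
  simp [Matrix.mul_apply, dotProduct, Matrix.mulVec]

lemma frame_expand (hS : Q * (Qᵀ * S) = 1) (v : Fin (2 * n) → ℝ) :
    v = ∑ c, ip n S (Q.col c) v • Q.col c := by
  conv_lhs => rw [← Matrix.one_mulVec v, ← hS, ← Matrix.mulVec_mulVec, ← Matrix.mulVec_mulVec]
  ext k
  simp only [Matrix.mulVec, dotProduct, Finset.sum_apply, Pi.smul_apply, smul_eq_mul, ip,
    Matrix.transpose_apply, Matrix.col_apply]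
  exact Finset.sum_congr rfl fun c _ => mul_comm _ _

lemma ip_comm (hsymm : Sᵀ = S) (u v : Fin (2 * n) → ℝ) : ip n S u v = ip n S v u := by
  unfold ip
  rw [Matrix.dotProduct_mulVec, ← Matrix.mulVec_transpose, hsymm, dotProduct_comm]

lemma bracket_col (hS : Q * (Qᵀ * S) = 1) (hsymm : Sᵀ = S) (a b : ι) :
    bracket n (Q.col a) (Q.col b) = ∑ c, cc S Q a b c • Q.col c := by
  rw [frame_expand hS (bracket n (Q.col a) (Q.col b))]
  simp only [cc]
  refine Finset.sum_congr rfl fun c _ => ?_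
  rw [ip_comm hsymm]

/-- trace of an endomorphism in the frame -/
lemma trace_frame (hS : Q * (Qᵀ * S) = 1) (f : (Fin (2 * n) → ℝ) →ₗ[ℝ] (Fin (2 * n) → ℝ)) :
    ∑ t, f (Pi.single t 1) t = ∑ b, ip n S (Q.col b) (f (Q.col b)) := by
  have h : ∀ t, f (Pi.single t 1) = ∑ c, ip n S (Q.col c) (Pi.single t 1) • f (Q.col c) := by
    intro t
    conv_lhs => rw [frame_expand hS (Pi.single t 1)]
    simp
  have h2 : ∀ b, ip n S (Q.col b) (f (Q.col b))
      = ∑ t, f (Q.col b) t * ip n S (Q.col b) (Pi.single t 1) := by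
    intro b
    conv_lhs => rw [vec_eq_sum (f (Q.col b))]
    simp only [ip_eq, map_sum, map_smul, smul_eq_mul]
  simp only [h, h2]
  simp only [Finset.sum_apply, Pi.smul_apply, smul_eq_mul]
  rw [Finset.sum_comm]
  exact Finset.sum_congr rfl fun c _ => Finset.sum_congr rfl fun t _ => mul_comm _ _

lemma curv_linear (u v : Fin (2 * n) → ℝ) : ∃ f : (Fin (2 * n) → ℝ) →ₗ[ℝ] (Fin (2 * n) → ℝ),
    ∀ t, f t = curv n S t u v := by
  refine ⟨(naL n S).flip (naL n S u v) - naL n S u ∘ₗ (naL n S).flip v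
    - (naL n S).flip v ∘ₗ (brL n).flip u, fun t => ?_⟩
  simp [curv, nabla_eq, bracket_eq]

lemma ricci_frame (hS : Q * (Qᵀ * S) = 1) (u v : Fin (2 * n) → ℝ) :
    ricci n S u v = ∑ b, ip n S (Q.col b) (curv n S (Q.col b) u v) := by
  obtain ⟨f, hf⟩ := curv_linear (S := S) u v
  simp only [ricci, ← hf]
  exact trace_frame hS f

/-- Ricci form as a bilinear map -/
lemma ricci_bilin : ∃ r : (Fin (2 * n) → ℝ) →ₗ[ℝ] (Fin (2 * n) → ℝ) →ₗ[ℝ] ℝ,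
    ∀ u v, r u v = ricci n S u v := by
  refine ⟨LinearMap.mk₂ ℝ (ricci n S) ?_ ?_ ?_ ?_, fun u v => rfl⟩ <;> intros <;>
  simp only [ricci, curv, nabla_eq, bracket_eq, map_add, map_smul, LinearMap.add_apply,
    LinearMap.smul_apply, ← Finset.sum_add_distrib, Finset.smul_sum] <;>
  refine Finset.sum_congr rfl fun i _ => ?_ <;>
  simp only [Pi.add_apply, Pi.sub_apply, Pi.smul_apply, smul_eq_mul] <;> ring

lemma scalar_frame (hinv : S⁻¹ = Q * Qᵀ) (hS : Q * (Qᵀ * S) = 1) :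
    scalarCurv n S = ∑ a, ∑ b, ip n S (Q.col b) (curv n S (Q.col b) (Q.col a) (Q.col a)) := by
  have : ∀ a, ∑ b, ip n S (Q.col b) (curv n S (Q.col b) (Q.col a) (Q.col a))
      = ∑ i, ∑ j, Q i a * Q j a * ricci n S (Pi.single i 1) (Pi.single j 1) := by
    intro a
    rw [← ricci_frame hS]
    obtain ⟨r, hr⟩ := ricci_bilin (S := S)
    simp only [← hr]
    conv_lhs => rw [vec_eq_sum (Q.col a)]
    simp only [map_sum, map_smul, LinearMap.sum_apply, LinearMap.smul_apply, smul_eq_mul,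
      Finset.mul_sum, Matrix.col_apply]
    rw [Finset.sum_comm]
    exact Finset.sum_congr rfl fun i _ => Finset.sum_congr rfl fun j _ => by ring
  simp only [this, scalarCurv, hinv, Matrix.mul_apply, Finset.sum_mul, Matrix.transpose_apply]
  conv_rhs => rw [Finset.sum_comm]
  refine Finset.sum_congr rfl fun i _ => ?_
  conv_rhs => rw [Finset.sum_comm]

lemma cc_anti (a b c : ι) : cc S Q a b c = - cc S Q b a c := by
  have h : ∀ u v, bracket n u v = - bracket n v u := by
    intro u v
    ext k
    simp only [bracket, Pi.neg_apply, ← Finset.sum_neg_distrib]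
    rw [Finset.sum_comm]
    refine Finset.sum_congr rfl fun i _ => Finset.sum_congr rfl fun j _ => ?_
    simp only [structC]; ring
  unfold cc
  rw [h]; simp [ip_eq]

lemma term_frame (h1 : Qᵀ * S * Q = 1) (hinv : S⁻¹ = Q * Qᵀ) (hS : Q * (Qᵀ * S) = 1)
    (hsymm : Sᵀ = S) (a b : ι) :
    ip n S (Q.col b) (curv n S (Q.col b) (Q.col a) (Q.col a))
      = ∑ s, (GG S Q a a s * GG S Q b s b - GG S Q b a s * GG S Q a s b
          - cc S Q b a s * GG S Q s a b) := by
  unfold curv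
  rw [nabla_col hinv, nabla_col hinv, bracket_col hS hsymm]
  simp only [nabla_eq, map_sum, map_smul, LinearMap.sum_apply, LinearMap.smul_apply]
  simp only [← nabla_eq, nabla_col hinv]
  simp only [ip_eq, map_sub, map_sum, map_smul, ipL_col h1, smul_eq_mul, Finset.sum_sub_distrib]
  simp

lemma sum3_cycle (f : ι → ι → ι → ℝ) : ∑ a, ∑ b, ∑ c, f a b c = ∑ a, ∑ b, ∑ c, f b c a := by
  conv_rhs => rw [Finset.sum_comm]
  refine Finset.sum_congr rfl fun b _ => ?_
  conv_rhs => rw [Finset.sum_comm]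

lemma sum3_swap (f : ι → ι → ι → ℝ) : ∑ a, ∑ b, ∑ c, f a b c = ∑ a, ∑ b, ∑ c, f b a c :=
  Finset.sum_comm

theorem scalar_general (h1 : Qᵀ * S * Q = 1) (hinv : S⁻¹ = Q * Qᵀ) (hS : Q * (Qᵀ * S) = 1)
    (hsymm : Sᵀ = S) :
    scalarCurv n S = - ∑ s, (∑ a, cc S Q s a a) ^ 2
      - 4⁻¹ * ∑ a, ∑ b, ∑ c, cc S Q a b c ^ 2
      - 2⁻¹ * ∑ a, ∑ b, ∑ c, cc S Q a b c * cc S Q a c b := by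
  rw [scalar_frame hinv hS]
  simp only [term_frame h1 hinv hS hsymm]
  have hA : ∑ a, ∑ b, ∑ s, (GG S Q a a s * GG S Q b s b) = - ∑ s, (∑ a, cc S Q s a a) ^ 2 := by
    have hz : ∀ a s, cc S Q a a s = 0 := fun a s => by linarith [cc_anti (S := S) (Q := Q) a a s]
    have e1 : ∀ a b s, GG S Q a a s * GG S Q b s b = - (cc S Q s a a * cc S Q s b b) := by
      intro a b s
      simp only [GG, hz]
      rw [cc_anti a s a, cc_anti b s b]; ring
    simp only [e1, sq, Finset.sum_mul_sum, Finset.sum_neg_distrib]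
    rw [sum3_cycle, sum3_cycle]
  have hB : ∑ a, ∑ b, ∑ s, (- (GG S Q b a s * GG S Q a s b) - cc S Q b a s * GG S Q s a b)
      = - 4⁻¹ * ∑ a, ∑ b, ∑ c, cc S Q a b c ^ 2
      - 2⁻¹ * ∑ a, ∑ b, ∑ c, cc S Q a b c * cc S Q a c b := by
    have e : ∀ a b s, (- (GG S Q b a s * GG S Q a s b) - cc S Q b a s * GG S Q s a b)
        = - (3/4) * cc S Q a b s ^ 2 + 4⁻¹ * cc S Q b s a ^ 2 + 4⁻¹ * cc S Q s a b ^ 2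
          - 2⁻¹ * (cc S Q a b s * cc S Q a s b) - 2⁻¹ * (cc S Q b s a * cc S Q b a s)
          + 2⁻¹ * (cc S Q s a b * cc S Q s b a) := by
      intro a b s
      simp only [GG]
      rw [cc_anti b a s, cc_anti a s b, cc_anti s b a]; ring
    simp only [e, Finset.sum_add_distrib, Finset.sum_sub_distrib, ← Finset.mul_sum]
    rw [← sum3_cycle (fun a b s => cc S Q a b s ^ 2),
      sum3_cycle (fun a b s => cc S Q s a b ^ 2),
      ← sum3_cycle (fun a b s => cc S Q a b s * cc S Q a s b),
      sum3_cycle (fun a b s => cc S Q s a b * cc S Q s b a)]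
    ring
  have : ∀ a b s, GG S Q a a s * GG S Q b s b - GG S Q b a s * GG S Q a s b
          - cc S Q b a s * GG S Q s a b = GG S Q a a s * GG S Q b s b +
          (- (GG S Q b a s * GG S Q a s b) - cc S Q b a s * GG S Q s a b) := by
    intros; ring
  simp only [this, Finset.sum_add_distrib]
  rw [hA, hB]; ring

end Gen

section Frame

variable {n : ℕ}

/-- Index of `X`. -/
def iX (hn : 2 ≤ n) : Fin (2 * n) := ⟨0, by omega⟩
/-- Index of `Y_i`. -/
def iY (i : Fin (n - 1)) : Fin (2 * n) := ⟨i.val + 1, by omega⟩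
/-- Index of `Z_i`. -/
def iZ (i : Fin (n - 1)) : Fin (2 * n) := ⟨i.val + n, by omega⟩
/-- Index of `W`. -/
def iW (hn : 2 ≤ n) : Fin (2 * n) := ⟨2 * n - 1, by omega⟩

/-- Block index type. -/
abbrev I4 (n : ℕ) : Type := (Unit ⊕ Fin (n - 1)) ⊕ (Fin (n - 1) ⊕ Unit)

/-- Block indices to indices. -/
def toI (hn : 2 ≤ n) : I4 n → Fin (2 * n)
  | .inl (.inl _) => iX hn
  | .inl (.inr i) => iY i
  | .inr (.inl i) => iZ i
  | .inr (.inr _) => iW hn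

lemma toI_bij (hn : 2 ≤ n) : Function.Bijective (toI hn) := by
  rw [Fintype.bijective_iff_injective_and_card]
  refine ⟨?_, by simp; omega⟩
  rintro ((_ | i) | (i | _)) ((_ | j) | (j | _)) h <;>
  simp [toI, iX, iY, iZ, iW, Fin.ext_iff] at h ⊢ <;> omega

lemma sum_blocks (hn : 2 ≤ n) (f : Fin (2 * n) → ℝ) :
    ∑ k, f k = f (iX hn) + ∑ i, f (iY i) + (∑ i, f (iZ i) + f (iW hn)) := by
  rw [← (toI_bij hn).sum_comp f]
  simp [Fintype.sum_sum_type, toI]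

/-- Vector with given block coordinates. -/
def mkv (n : ℕ) (a : ℝ) (y z : Fin (n - 1) → ℝ) (w : ℝ) : Fin (2 * n) → ℝ := fun k =>
  if k.val = 0 then a
  else if h : 1 ≤ k.val ∧ k.val ≤ n - 1 then y ⟨k.val - 1, by omega⟩
  else if h : n ≤ k.val ∧ k.val ≤ 2 * n - 2 then z ⟨k.val - n, by omega⟩
  else w

section
variable (hn : 2 ≤ n) (a : ℝ) (y z : Fin (n - 1) → ℝ) (w : ℝ)

lemma mkv_X : mkv n a y z w (iX hn) = a := by simp [mkv, iX]
lemma mkv_Y (i) : mkv n a y z w (iY i) = y i := by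
  have h : (iY i).val = i.val + 1 := rfl
  have := i.2
  unfold mkv
  rw [if_neg (by omega), dif_pos (by omega)]; simp [h]
lemma mkv_Z (i) : mkv n a y z w (iZ i) = z i := by
  have h : (iZ i).val = i.val + n := rfl
  have := i.2
  unfold mkv
  rw [if_neg (by omega), dif_neg (by omega), dif_pos (by omega)]; simp [h]
lemma mkv_W : mkv n a y z w (iW hn) = w := by
  have h : (iW hn).val = 2 * n - 1 := rfl
  unfold mkv
  rw [if_neg (by omega), dif_neg (by omega), dif_neg (by omega)]
end

lemma ext_blocks (hn : 2 ≤ n) (u v : Fin (2 * n) → ℝ) (hX : u (iX hn) = v (iX hn))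
    (hY : ∀ i, u (iY i) = v (iY i)) (hZ : ∀ i, u (iZ i) = v (iZ i))
    (hW : u (iW hn) = v (iW hn)) : u = v := by
  ext k
  obtain ⟨((_ | i) | (i | _)), rfl⟩ := (toI_bij hn).2 k
  exacts [hX, hY i, hZ i, hW]

/-- Table of structure constants. -/
def tbl (n : ℕ) : I4 n → I4 n → I4 n → ℝ
  | .inl (.inl _), .inl (.inr i), .inl (.inr j) => if i = j then 1 / 2 else 0
  | .inl (.inr i), .inl (.inl _), .inl (.inr j) => if i = j then -(1 / 2) else 0
  | .inl (.inl _), .inr (.inl i), .inr (.inl j) => if i = j then 1 / 2 else 0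
  | .inr (.inl i), .inl (.inl _), .inr (.inl j) => if i = j then -(1 / 2) else 0
  | .inl (.inl _), .inr (.inr _), .inr (.inr _) => 1
  | .inr (.inr _), .inl (.inl _), .inr (.inr _) => -1
  | .inr (.inl i), .inl (.inr j), .inr (.inr _) => if i = j then 1 else 0
  | .inl (.inr i), .inr (.inl j), .inr (.inr _) => if i = j then -1 else 0
  | _, _, _ => 0

lemma structC_toI (hn : 2 ≤ n) (a b c : I4 n) :
    structC n (toI hn a) (toI hn b) (toI hn c) = tbl n a b c := by
  have hX : (iX hn).val = 0 := rfl
  have hW : (iW hn).val = 2 * n - 1 := rfl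
  have hY : ∀ i : Fin (n - 1), (iY i).val = i.val + 1 := fun _ => rfl
  have hZ : ∀ i : Fin (n - 1), (iZ i).val = i.val + n := fun _ => rfl
  rcases a with ((_ | i) | (i | _)) <;> rcases b with ((_ | j) | (j | _)) <;>
  rcases c with ((_ | k) | (k | _)) <;>
  simp only [toI, structC, tbl, Fin.ext_iff, hX, hY, hZ, hW] <;>
  (try have hi := i.2) <;> (try have hj := j.2) <;> (try have hk := k.2) <;>
  grind (splits := 20)

/-- Table of the metric. -/
def stbl (n : ℕ) (p : ℝ) (x σ : Fin (n - 1) → ℝ) (β : ℝ) : I4 n → I4 n → ℝ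
  | .inl (.inl _), .inl (.inl _) => p
  | .inl (.inl _), .inl (.inr i) => x i
  | .inl (.inr i), .inl (.inl _) => x i
  | .inl (.inr i), .inl (.inr j) => if i = j then σ i else 0
  | .inr (.inl i), .inr (.inl j) => if i = j then σ i else 0
  | .inr (.inr _), .inr (.inr _) => β
  | _, _ => 0

lemma Sform_toI (hn : 2 ≤ n) (p β : ℝ) (x σ : Fin (n - 1) → ℝ) (a b : I4 n) :
    Sform n p x σ β (toI hn a) (toI hn b) = stbl n p x σ β a b := by
  have hX : (iX hn).val = 0 := rfl
  have hW : (iW hn).val = 2 * n - 1 := rfl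
  have hY : ∀ i : Fin (n - 1), (iY i).val = i.val + 1 := fun _ => rfl
  have hZ : ∀ i : Fin (n - 1), (iZ i).val = i.val + n := fun _ => rfl
  rcases a with ((_ | i) | (i | _)) <;> rcases b with ((_ | j) | (j | _)) <;>
  simp only [toI, Sform, stbl, Fin.ext_iff, hX, hY, hZ, hW] <;>
  (try have hi := i.2) <;> (try have hj := j.2) <;>
  grind

lemma sum_toI (hn : 2 ≤ n) (f : Fin (2 * n) → ℝ) : ∑ k, f k = ∑ a, f (toI hn a) :=
  ((toI_bij hn).sum_comp f).symm

/-- Block coordinates as a function on block indices. -/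
def bco (a : ℝ) (y z : Fin (n - 1) → ℝ) (w : ℝ) : I4 n → ℝ
  | .inl (.inl _) => a
  | .inl (.inr i) => y i
  | .inr (.inl i) => z i
  | .inr (.inr _) => w

lemma mkv_toI (hn : 2 ≤ n) (a : ℝ) (y z : Fin (n - 1) → ℝ) (w : ℝ) (t : I4 n) :
    mkv n a y z w (toI hn t) = bco a y z w t := by
  rcases t with ((_ | i) | (i | _))
  exacts [mkv_X hn _ _ _ _, mkv_Y _ _ _ _ _, mkv_Z _ _ _ _ _, mkv_W hn _ _ _ _]

lemma bracket_mkv (hn : 2 ≤ n) (a a' : ℝ) (y z y' z' : Fin (n - 1) → ℝ) (w w' : ℝ) :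
    bracket n (mkv n a y z w) (mkv n a' y' z' w')
      = mkv n 0 (fun i => (a * y' i - a' * y i) / 2) (fun i => (a * z' i - a' * z i) / 2)
        (a * w' - a' * w + ∑ i, (z i * y' i - z' i * y i)) := by
  ext k
  obtain ⟨t, rfl⟩ := (toI_bij hn).2 k
  simp only [bracket, sum_toI hn, mkv_toI, structC_toI]
  rcases t with ((_ | i) | (i | _)) <;>
  simp [Fintype.sum_sum_type, tbl, bco, Finset.sum_sub_distrib, mul_comm] <;> ring

lemma ip_mkv (hn : 2 ≤ n) (p β : ℝ) (x σ : Fin (n - 1) → ℝ)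
    (a a' : ℝ) (y z y' z' : Fin (n - 1) → ℝ) (w w' : ℝ) :
    ip n (Sform n p x σ β) (mkv n a y z w) (mkv n a' y' z' w')
      = a * p * a' + a * ∑ i, x i * y' i + a' * ∑ i, x i * y i + ∑ i, σ i * y i * y' i
        + ∑ i, σ i * z i * z' i + β * w * w' := by
  simp only [ip, dotProduct, Matrix.mulVec, sum_toI hn, mkv_toI, Sform_toI]
  simp [Fintype.sum_sum_type, stbl, bco, mul_add, Finset.sum_add_distrib, Finset.mul_sum,
    mul_comm, mul_left_comm]
  ring

/-- Orthonormal frame. -/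
def qf (x σ : Fin (n - 1) → ℝ) (r : ℝ) (s : Fin (n - 1) → ℝ) (w : ℝ) : I4 n → Fin (2 * n) → ℝ
  | .inl (.inl _) => mkv n r (fun i => -(r * (x i / σ i))) 0 0
  | .inl (.inr i) => mkv n 0 (Pi.single i (s i)) 0 0
  | .inr (.inl i) => mkv n 0 0 (Pi.single i (s i)) 0
  | .inr (.inr _) => mkv n 0 0 0 w

/-- Structure constants in the orthonormal frame. -/
def ctb (x σ : Fin (n - 1) → ℝ) (β r : ℝ) (s : Fin (n - 1) → ℝ) (w : ℝ) :
    I4 n → I4 n → I4 n → ℝ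
  | .inl (.inl _), .inl (.inr i), .inl (.inr j) => if i = j then r / 2 else 0
  | .inl (.inr i), .inl (.inl _), .inl (.inr j) => if i = j then -(r / 2) else 0
  | .inl (.inl _), .inr (.inl i), .inr (.inl j) => if i = j then r / 2 else 0
  | .inr (.inl i), .inl (.inl _), .inr (.inl j) => if i = j then -(r / 2) else 0
  | .inl (.inl _), .inr (.inl i), .inr (.inr _) => r * s i * (x i / σ i) * w * β
  | .inr (.inl i), .inl (.inl _), .inr (.inr _) => -(r * s i * (x i / σ i) * w * β)
  | .inl (.inl _), .inr (.inr _), .inr (.inr _) => r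
  | .inr (.inr _), .inl (.inl _), .inr (.inr _) => -r
  | .inr (.inl i), .inl (.inr j), .inr (.inr _) => if i = j then s i ^ 2 * w * β else 0
  | .inl (.inr i), .inr (.inl j), .inr (.inr _) => if i = j then -(s i ^ 2 * w * β) else 0
  | _, _, _ => 0

section
lemma ip_qf (hn : 2 ≤ n) {p β : ℝ} {x σ : Fin (n - 1) → ℝ} (hσ : ∀ i, σ i ≠ 0)
    {r w : ℝ} {s : Fin (n - 1) → ℝ} (hr : r ^ 2 * (p - ∑ i, x i ^ 2 / σ i) = 1)
    (hs : ∀ i, s i ^ 2 * σ i = 1) (hw : w ^ 2 * β = 1) (a b : I4 n) :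
    ip n (Sform n p x σ β) (qf x σ r s w a) (qf x σ r s w b)
    = if a = b then 1 else 0 := by
  have hc : ∀ i, σ i * (x i / σ i) = x i := fun i => by field_simp [hσ i]
  rcases a with ((_ | i) | (i | _)) <;> rcases b with ((_ | j) | (j | _)) <;>
  simp only [qf, ip_mkv hn]
  · have e1 : ∑ i, x i * -(r * (x i / σ i)) = - (r * ∑ i, x i ^ 2 / σ i) := by
      rw [Finset.mul_sum, ← Finset.sum_neg_distrib]
      exact Finset.sum_congr rfl fun i _ => by ring
    have e2 : ∑ i, σ i * -(r * (x i / σ i)) * -(r * (x i / σ i))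
        = r ^ 2 * ∑ i, x i ^ 2 / σ i := by
      rw [Finset.mul_sum]
      exact Finset.sum_congr rfl fun i _ => by have := hσ i; field_simp
    rw [e1, e2]; simp; linarith
  all_goals simp [Pi.single_apply]
  · linear_combination (-r * s j) * hc j
  · linear_combination (-r * s i) * hc i
  · by_cases h : i = j
    · subst h; simp; linarith [hs i]
    · simp [h, Ne.symm h]
  · by_cases h : i = j
    · subst h; simp; linarith [hs i]
    · simp [h, Ne.symm h]
  · linarith

lemma cc_qf (hn : 2 ≤ n) {p β : ℝ} {x σ : Fin (n - 1) → ℝ} (hσ : ∀ i, σ i ≠ 0)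
    {r w : ℝ} {s : Fin (n - 1) → ℝ} (_hr : r ^ 2 * (p - ∑ i, x i ^ 2 / σ i) = 1)
    (hs : ∀ i, s i ^ 2 * σ i = 1) (hw : w ^ 2 * β = 1) (a b c : I4 n) :
    ip n (Sform n p x σ β)
    (bracket n (qf x σ r s w a) (qf x σ r s w b)) (qf x σ r s w c) = ctb x σ β r s w a b c := by
  have hc : ∀ i, σ i * (x i / σ i) = x i := fun i => by field_simp [hσ i]
  rcases a with ((_ | i) | (i | _)) <;> rcases b with ((_ | j) | (j | _)) <;>
  rcases c with ((_ | k) | (k | _)) <;>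
  simp [qf, ip_mkv hn, bracket_mkv hn, ctb, Pi.single_apply]
  · simp [ite_div]
    linear_combination (-r * r * s j / 2) * hc j
  · by_cases h : k = j
    · subst h; simp; linear_combination (r / 2) * hs k
    · simp [h, Ne.symm h]
  · by_cases h : k = j
    · subst h; simp; linear_combination (r / 2) * hs k
    · simp [h, Ne.symm h]
  · ring
  · linear_combination r * hw
  · simp [ite_div, neg_div]
    linear_combination (r * r * s i / 2) * hc i
  · by_cases h : k = i
    · subst h; simp; linear_combination (-r / 2) * hs k
    · simp [h, Ne.symm h]
  · by_cases h : i = j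
    · subst h; simp; ring
    · simp [h]
  · by_cases h : k = i
    · subst h; simp; linear_combination (-r / 2) * hs k
    · simp [h, Ne.symm h]
  · ring
  · by_cases h : i = j
    · subst h; simp; ring
    · simp [h, Ne.symm h]
  · linear_combination r * hw
end

lemma ctb_sum_sq (hnc : ((n - 1 : ℕ) : ℝ) = n - 1) (x σ : Fin (n - 1) → ℝ) (β r : ℝ)
    (s : Fin (n - 1) → ℝ) (w : ℝ) :
    ∑ a, ∑ b, ∑ c, ctb x σ β r s w a b c ^ 2 = (n - 1) * r ^ 2 + 2 * r ^ 2
      + 2 * ∑ i, (r * s i * (x i / σ i) * w * β) ^ 2 + 2 * ∑ i, (s i ^ 2 * w * β) ^ 2 := by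
  simp only [Fintype.sum_sum_type, ctb]
  simp only [ite_pow, neg_sq, ne_eq, OfNat.ofNat_ne_zero, not_false_eq_true, zero_pow,
    Finset.sum_const_zero, Finset.sum_ite_eq, Finset.mem_univ, if_true, add_zero, zero_add,
    Finset.sum_add_distrib, Finset.sum_const, Finset.card_univ, Fintype.card_fin,
    Fintype.card_unit, nsmul_eq_mul, hnc, one_smul]
  ring

lemma ctb_sum_mix (hnc : ((n - 1 : ℕ) : ℝ) = n - 1) (x σ : Fin (n - 1) → ℝ) (β r : ℝ)
    (s : Fin (n - 1) → ℝ) (w : ℝ) :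
    ∑ a, ∑ b, ∑ c, ctb x σ β r s w a b c * ctb x σ β r s w a c b
      = (n - 1) * r ^ 2 / 2 + r ^ 2 := by
  simp only [Fintype.sum_sum_type, ctb]
  simp only [mul_ite, ite_mul, mul_zero, zero_mul,
    Finset.sum_const_zero, Finset.sum_ite_eq, Finset.sum_ite_eq', Finset.mem_univ, if_true,
    add_zero, zero_add,
    Finset.sum_add_distrib, Finset.sum_const, Finset.card_univ, Fintype.card_fin,
    Fintype.card_unit, nsmul_eq_mul, hnc, one_smul]
  ring

lemma Sform_symm (hn : 2 ≤ n) (p β : ℝ) (x σ : Fin (n - 1) → ℝ) :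
    (Sform n p x σ β)ᵀ = Sform n p x σ β := by
  ext i j
  obtain ⟨a, rfl⟩ := (toI_bij hn).2 i
  obtain ⟨b, rfl⟩ := (toI_bij hn).2 j
  rw [Matrix.transpose_apply, Sform_toI, Sform_toI]
  rcases a with ((_ | i) | (i | _)) <;> rcases b with ((_ | j) | (j | _)) <;> simp [stbl] <;>
  grind

end Frame

/-- The scalar curvature of `g(p,x,σ,β)` equals
`τ = -(1/(2z)) (2n² + n + 1 + β Σ_i σ_i⁻²(z + x_i²/σ_i))`. -/
theorem scalar_curvature_formula (n : ℕ) (hn : 2 ≤ n) (p β : ℝ)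
    (x σ : Fin (n - 1) → ℝ)
    (hadm : Admissible n p x σ β) (hz : 0 < zval n p x σ) :
    scalarCurv n (Sform n p x σ β)
      = -(1 / (2 * zval n p x σ)) *
          (2 * (n : ℝ) ^ 2 + n + 1
            + β * ∑ i, (1 / (σ i) ^ 2) * (zval n p x σ + (x i) ^ 2 / σ i)) := by
  obtain ⟨-, hβ, -, -, hσ1, -⟩ := hadm
  have hσ : ∀ i, 0 < σ i := fun i => lt_of_lt_of_le one_pos (hσ1 i)
  have hex : ∀ t : ℝ, 0 < t → ∃ r : ℝ, r ^ 2 * t = 1 := fun t ht =>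
    ⟨(Real.sqrt t)⁻¹, by rw [inv_pow, Real.sq_sqrt ht.le]; exact inv_mul_cancel₀ ht.ne'⟩
  obtain ⟨r, hr⟩ := hex _ hz
  obtain ⟨w, hw⟩ := hex _ hβ
  choose s hs using fun i => hex _ (hσ i)
  have hr' : r ^ 2 * (p - ∑ i, x i ^ 2 / σ i) = 1 := hr
  have hσ' : ∀ i, σ i ≠ 0 := fun i => (hσ i).ne'
  set S := Sform n p x σ β with hSdef
  let Q : Matrix (Fin (2 * n)) (I4 n) ℝ := Matrix.of fun k a => qf x σ r s w a k
  have hcol : ∀ a, Q.col a = qf x σ r s w a := fun a => rfl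
  have h1 : Qᵀ * S * Q = 1 := by
    ext a b
    rw [Matrix.one_apply, ← ip_qf hn hσ' hr' hs hw a b, ← hcol, ← hcol, ip, Matrix.mul_assoc]
    simp [Matrix.mul_apply, dotProduct, Matrix.mulVec, hSdef]
  have hcard : Fintype.card (Fin (2 * n)) = Fintype.card (I4 n) := by simp; omega
  have hS : Q * (Qᵀ * S) = 1 :=
    (Matrix.mul_eq_one_comm_of_card_eq _ _ _ hcard).2 h1
  have hinv : S⁻¹ = Q * Qᵀ := Matrix.inv_eq_left_inv (by rw [Matrix.mul_assoc]; exact hS)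
  rw [scalar_general h1 hinv hS (Sform_symm hn p β x σ)]
  have hcc : ∀ a b c, cc S Q a b c = ctb x σ β r s w a b c := fun a b c =>
    cc_qf hn hσ' hr' hs hw a b c
  simp only [hcc]
  have hz1 : r ^ 2 = 1 / zval n p x σ := by field_simp; linarith
  have hs1 : ∀ i, s i ^ 2 = 1 / σ i := fun i => by have := hσ' i; field_simp; linarith [hs i]
  have hw1 : w ^ 2 * β ^ 2 = β := by linear_combination β * hw
  have hnc : ((n - 1 : ℕ) : ℝ) = n - 1 := by push_cast [Nat.cast_sub (by omega : 1 ≤ n)]; ring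
  have A1 : ∑ t, (∑ a, ctb x σ β r s w t a a) ^ 2 = (n : ℝ) ^ 2 * r ^ 2 := by
    simp [Fintype.sum_sum_type, ctb, hnc]
    ring
  have A2 : ∑ a, ∑ b, ∑ c, ctb x σ β r s w a b c ^ 2 = (n - 1) * r ^ 2 + 2 * r ^ 2
      + 2 * ∑ i, (r * s i * (x i / σ i) * w * β) ^ 2 + 2 * ∑ i, (s i ^ 2 * w * β) ^ 2 := 
    ctb_sum_sq hnc x σ β r s w
  have A3 : ∑ a, ∑ b, ∑ c, ctb x σ β r s w a b c * ctb x σ β r s w a c b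
      = (n - 1) * r ^ 2 / 2 + r ^ 2 := 
    ctb_sum_mix hnc x σ β r s w
  rw [A1, A2, A3]
  have B : 2 * ∑ i, (r * s i * (x i / σ i) * w * β) ^ 2 + 2 * ∑ i, (s i ^ 2 * w * β) ^ 2
      = 2 * r ^ 2 * (β * ∑ i, (1 / (σ i) ^ 2) * (zval n p x σ + (x i) ^ 2 / σ i)) := by
    simp only [Finset.mul_sum, ← Finset.sum_add_distrib]
    refine Finset.sum_congr rfl fun i _ => ?_
    have e : 2 * (r * s i * (x i / σ i) * w * β) ^ 2 + 2 * (s i ^ 2 * w * β) ^ 2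
      = 2 * (w ^ 2 * β ^ 2) * (r ^ 2 * s i ^ 2 * (x i / σ i) ^ 2 + (s i ^ 2) ^ 2) := by ring
    rw [e, hw1, hs1, hz1]
    have := hσ' i
    field_simp
    ring
  have e2 : (1 / (2 * zval n p x σ)) = r ^ 2 / 2 := by rw [hz1]; field_simp
  rw [e2]
  linear_combination (-1 / 4) * B

end CHn
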